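/- Under the AOA algorithm (losses valued in [0,1], convex, G-Lipschitz gradients, domain diameter at most D), for every interval J = [i,j] in the geometric covering collection 𝓘 and every comparator sequence u_i,…,u_j ∈ Ω, Σ_{t=i}^{j} f_t(w_t) − Σ_{t=i}^{j} f_t(u_t) ≤ √( 3·|J|·c'(j) ) + (3G/4)·√( 2·|J|·(7D² + 4D·P_J) ) + (√(2|J|)/4)·( 1 + 2·ln(k_J+1) ), where |J| = j−i+1, c'(j) = 1 + ln j + ln(1 + log₂ j) + ln( (5 + 3 ln(1+j))/2 ), P_J = Σ_{t=i}^{j−1} ‖u_{t+1}−u_t‖₂, and k_J = ⌊ (1/2)·log₂(1 + 4P_J/(7D)) ⌋ + 1. -/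

import Mathlib

/-- The AdaNormalHedge potential `Φ(R,C) = exp([R]₊²/(3C))` (with `Φ(R,0) = 1`,
matching `Φ(0,0) = 1`, since `x/0 = 0` in Lean). -/
noncomputable def anhPot (R C : ℝ) : ℝ := Real.exp (max R 0 ^ 2 / (3 * C))

/-- The AdaNormalHedge weight function `w(R,C) = (Φ(R+1,C+1) − Φ(R−1,C+1))/2`. -/
noncomputable def anhW (R C : ℝ) : ℝ := (anhPot (R + 1) (C + 1) - anhPot (R - 1) (C + 1)) / 2

/-- The number of experts of Ader with horizon `m`: `N = ⌈(1/2)log₂(1 + 4m/7)⌉ + 1`. -/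
noncomputable def aderN (m : ℕ) : ℕ := ⌈Real.logb 2 (1 + 4 * (m : ℝ) / 7) / 2⌉₊ + 1

/-- The `j`-th step size of Ader with horizon `m`: `η_j = 2^{j−1}(D/G)√(7/(2m))`. -/
noncomputable def aderEta (D G : ℝ) (m j : ℕ) : ℝ :=
  2 ^ (j - 1) * (D / G) * Real.sqrt (7 / (2 * (m : ℝ)))

/-- The Hedge learning rate of Ader with horizon `m`: `α = √(8/m)`. -/
noncomputable def aderAlpha (m : ℕ) : ℝ := Real.sqrt (8 / (m : ℝ))

/-- The levels `k` whose geometric covering interval `[i·2^k, (i+1)·2^k − 1] ∈ 𝓘_k`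
containing round `t` has index `i = ⌊t/2^k⌋ ≥ 1`; these index the experts of AOA
active at round `t` (one per level). -/
def gcLevels (t : ℕ) : Finset ℕ := (Finset.range (t + 1)).filter fun k => 2 ^ k ≤ t

/-- `R_{t−1,I} = Σ_{u=min I}^{t−1} (f_u(w_u) − f_u(w_{u,I}))` for the active level-`k`
expert at round `t`, whose interval `I ∈ 𝓘_k` has index `⌊t/2^k⌋` and starts at
`⌊t/2^k⌋·2^k`; `wI k i u` is the action at round `u` of the Ader expert associated
with the `i`-th interval of level `k`. -/
noncomputable def aoaMetaR {α : Type*} (f : ℕ → α → ℝ) (w : ℕ → α)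
    (wI : ℕ → ℕ → ℕ → α) (k t : ℕ) : ℝ :=
  ∑ u ∈ Finset.Icc (t / 2 ^ k * 2 ^ k) (t - 1), (f u (w u) - f u (wI k (t / 2 ^ k) u))

/-- `C_{t−1,I} = Σ_{u=min I}^{t−1} |f_u(w_u) − f_u(w_{u,I})|` for the active level-`k`
expert at round `t`. -/
noncomputable def aoaMetaC {α : Type*} (f : ℕ → α → ℝ) (w : ℕ → α)
    (wI : ℕ → ℕ → ℕ → α) (k t : ℕ) : ℝ :=
  ∑ u ∈ Finset.Icc (t / 2 ^ k * 2 ^ k) (t - 1), |f u (w u) - f u (wI k (t / 2 ^ k) u)|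

/-- The AdaNormalHedge weight `p_{t,I}` that AOA assigns to the active level-`k`
expert at round `t`. -/
noncomputable def aoaWeight {α : Type*} (f : ℕ → α → ℝ) (w : ℕ → α)
    (wI : ℕ → ℕ → ℕ → α) (k t : ℕ) : ℝ :=
  anhW (aoaMetaR f w wI k t) (aoaMetaC f w wI k t) /
    ∑ k' ∈ gcLevels t, anhW (aoaMetaR f w wI k' t) (aoaMetaC f w wI k' t)

/-- `c'(t) = 1 + ln t + ln(1 + log₂ t) + ln((5 + 3 ln(1+t))/2)`. -/
noncomputable def cAOA (t : ℕ) : ℝ :=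
  1 + Real.log t + Real.log (1 + Real.logb 2 t) + Real.log ((5 + 3 * Real.log (1 + (t : ℝ))) / 2)

lemma sq_convexComb_div_le {x y p q r : ℝ} (hr0 : 0 ≤ r) (hr1 : r ≤ 1)
    (hp : 0 ≤ p) (hq : 0 < q) (hxp : p = 0 → x = 0) :
    ((1 - r) * x + r * y) ^ 2 / ((1 - r) * p + r * q) ≤
      (1 - r) * (x ^ 2 / p) + r * (y ^ 2 / q) := by
  rcases hp.eq_or_lt with hp0 | hp0
  · have hx := hxp hp0.symm
    subst hx
    rw [← hp0]
    rcases hr0.eq_or_lt with h | h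
    · simp [← h]
    · apply le_of_eq
      field_simp
      ring
  · have hd : 0 < (1 - r) * p + r * q := by
      rcases hr0.eq_or_lt with h | h
      · simpa [← h] using hp0
      · have : 0 ≤ (1 - r) * p := mul_nonneg (by linarith) hp
        positivity
    rw [div_le_iff₀ hd]
    have key : ((1 - r) * (x ^ 2 / p) + r * (y ^ 2 / q)) * ((1 - r) * p + r * q)
        - ((1 - r) * x + r * y) ^ 2 = (1 - r) * r * ((x * q - y * p) ^ 2 / (p * q)) := by
      field_simp
      ring
    have : 0 ≤ (1 - r) * r * ((x * q - y * p) ^ 2 / (p * q)) :=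
      mul_nonneg (mul_nonneg (by linarith) hr0) (by positivity)
    linarith

/-- Joint convexity of the AdaNormalHedge potential along a segment ending at `C' > 0`. -/
lemma anhPot_convexComb_le {R R' C C' r : ℝ} (hr0 : 0 ≤ r) (hr1 : r ≤ 1)
    (hC : 0 ≤ C) (hC' : 0 < C') (hRC : C = 0 → R ≤ 0) :
    anhPot ((1 - r) * R + r * R') ((1 - r) * C + r * C') ≤
      (1 - r) * anhPot R C + r * anhPot R' C' := by
  have hmax : max ((1 - r) * R + r * R') 0 ≤ (1 - r) * max R 0 + r * max R' 0 := by
    apply max_le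
    · exact add_le_add (mul_le_mul_of_nonneg_left (le_max_left _ _) (by linarith))
        (mul_le_mul_of_nonneg_left (le_max_left _ _) hr0)
    · exact add_nonneg (mul_nonneg (by linarith) (le_max_right _ _))
        (mul_nonneg hr0 (le_max_right _ _))
  have hden : 0 ≤ (1 - r) * C + r * C' :=
    add_nonneg (mul_nonneg (by linarith) hC) (mul_nonneg hr0 hC'.le)
  have hexp : max ((1 - r) * R + r * R') 0 ^ 2 / (3 * ((1 - r) * C + r * C')) ≤
      (1 - r) * (max R 0 ^ 2 / (3 * C)) + r * (max R' 0 ^ 2 / (3 * C')) := by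
    have h1 : max ((1 - r) * R + r * R') 0 ^ 2 / (3 * ((1 - r) * C + r * C')) ≤
        ((1 - r) * max R 0 + r * max R' 0) ^ 2 / (3 * ((1 - r) * C + r * C')) := by
      gcongr
    refine h1.trans ?_
    have h2 := sq_convexComb_div_le (x := max R 0) (y := max R' 0) (p := 3 * C) (q := 3 * C')
      hr0 hr1 (by positivity) (by positivity) (fun h => max_eq_right (hRC (by linarith)))
    have e : 3 * ((1 - r) * C + r * C') = (1 - r) * (3 * C) + r * (3 * C') := by ring
    rw [e]
    exact h2
  unfold anhPot
  refine (Real.exp_le_exp.2 hexp).trans ?_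
  have := convexOn_exp.2 (Set.mem_univ (max R 0 ^ 2 / (3 * C)))
    (Set.mem_univ (max R' 0 ^ 2 / (3 * C'))) (by linarith : 0 ≤ 1 - r) hr0 (by ring)
  simpa [smul_eq_mul] using this

lemma anhPot_midpoint_le {R C : ℝ} (hC : 0 ≤ C) (hRC : C = 0 → R ≤ 0) :
    (anhPot (R + 1) (C + 1) + anhPot (R - 1) (C + 1)) / 2 ≤
      anhPot R C + 3 / (2 * (C + 1)) := by
  have hC1 : 0 < C + 1 := by linarith
  rcases le_or_gt R 0 with hR | hR
  · have h1 : anhPot R C = 1 := by simp [anhPot, max_eq_right hR]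
    have h2 : anhPot (R - 1) (C + 1) = 1 := by
      simp [anhPot, max_eq_right (by linarith : R - 1 ≤ 0)]
    set x := 1 / (C + 1) with hx
    have hx0 : 0 ≤ x := by positivity
    have hx1 : x ≤ 1 := by rw [hx, div_le_one hC1]; linarith
    have h3 : anhPot (R + 1) (C + 1) ≤ Real.exp (x / 3) := by
      unfold anhPot
      apply Real.exp_le_exp.2
      have : max (R + 1) 0 ≤ 1 := max_le (by linarith) zero_le_one
      have h4 : max (R + 1) 0 ^ 2 ≤ 1 := pow_le_one₀ (le_max_right _ _) this
      calc max (R + 1) 0 ^ 2 / (3 * (C + 1)) ≤ 1 / (3 * (C + 1)) := by gcongr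
        _ = x / 3 := by rw [hx]; field_simp
    have h5 : Real.exp (x / 3) ≤ 1 + 3 * x := by
      have := Real.abs_exp_sub_one_le (x := x / 3) (by rw [abs_of_nonneg (by positivity)]; linarith)
      have h6 := (abs_le.1 this).2
      rw [abs_of_nonneg (by positivity)] at h6
      linarith
    have h7 : 3 / (2 * (C + 1)) = 3 / 2 * x := by rw [hx]; field_simp
    rw [h1, h2, h7]
    linarith
  · have hC0 : 0 < C := lt_of_le_of_ne hC fun h => absurd (hRC h.symm) (not_le.2 hR)
    set s := 1 / (3 * (C + 1)) with hs
    set A := R ^ 2 / (3 * C) with hA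
    have hs0 : 0 < s := by positivity
    have hs1 : s ≤ 1 / 3 := by
      rw [hs]
      apply div_le_div_of_nonneg_left <;> linarith
    have hA0 : 0 ≤ A := by positivity
    have h1 : anhPot R C = Real.exp A := by simp [anhPot, max_eq_left hR.le, hA]
    have h2 : anhPot (R + 1) (C + 1) = Real.exp ((R ^ 2 + 1) * s + 2 * R * s) := by
      rw [anhPot, max_eq_left (by linarith), hs]
      congr 1
      field_simp
      ring
    have h3 : anhPot (R - 1) (C + 1) ≤ Real.exp ((R ^ 2 + 1) * s - 2 * R * s) := by
      have h4 : max (R - 1) 0 ^ 2 ≤ (R - 1) ^ 2 := by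
        rcases le_total (R - 1) 0 with h | h
        · rw [max_eq_right h, zero_pow two_ne_zero]; positivity
        · rw [max_eq_left h]
      calc anhPot (R - 1) (C + 1) ≤ Real.exp ((R - 1) ^ 2 / (3 * (C + 1))) := by
            unfold anhPot; gcongr
        _ = _ := by
            congr 1
            rw [hs]
            field_simp
            ring
    have hcosh := Real.cosh_le_exp_half_sq (2 * R * s)
    rw [Real.cosh_eq] at hcosh
    have h5 : (anhPot (R + 1) (C + 1) + anhPot (R - 1) (C + 1)) / 2 ≤
        Real.exp ((R ^ 2 + 1) * s + (2 * R * s) ^ 2 / 2) := by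
      rw [Real.exp_add]
      refine le_trans ?_ (mul_le_mul_of_nonneg_left hcosh (Real.exp_pos _).le)
      rw [h2]
      rw [Real.exp_sub] at h3
      rw [Real.exp_add, Real.exp_neg]
      rw [div_eq_mul_inv] at h3
      linarith
    have h6 : (R ^ 2 + 1) * s + (2 * R * s) ^ 2 / 2 ≤ A + (1 - A) * s := by
      have e : A + (1 - A) * s - ((R ^ 2 + 1) * s + (2 * R * s) ^ 2 / 2) =
          2 * R ^ 2 / (9 * C * (C + 1) ^ 2) := by
        rw [hA, hs]
        field_simp
        ring
      have : 0 ≤ 2 * R ^ 2 / (9 * C * (C + 1) ^ 2) := by positivity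
      linarith
    have h7 : Real.exp (A + (1 - A) * s) ≤ Real.exp A + 9 / 2 * s := by
      rcases le_or_gt 1 A with hA1 | hA1
      · have : Real.exp (A + (1 - A) * s) ≤ Real.exp A := by
          apply Real.exp_le_exp.2
          nlinarith
        linarith
      · set B := A + (1 - A) * s with hB
        have hB1 : B ≤ 1 := by nlinarith
        have h8 : Real.exp B - Real.exp A ≤ (B - A) * Real.exp B := by
          have := Real.add_one_le_exp (A - B)
          have h9 : Real.exp A = Real.exp (A - B) * Real.exp B := by
            rw [← Real.exp_add]; ring_nf
          rw [h9]
          nlinarith [Real.exp_pos B]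
        have h10 : Real.exp B ≤ 3 := by
          have := Real.exp_le_exp.2 hB1
          linarith [Real.exp_one_lt_d9]
        have h11 : B - A ≤ s := by rw [hB]; nlinarith
        have h12 : (B - A) * Real.exp B ≤ s * 3 :=
          mul_le_mul h11 h10 (Real.exp_pos _).le hs0.le
        linarith
    have h13 : 3 / (2 * (C + 1)) = 9 / 2 * s := by
      rw [hs]; field_simp; norm_num
    rw [h1, h13]
    exact h5.trans ((Real.exp_le_exp.2 h6).trans h7)

/-- One-step growth of the AdaNormalHedge potential. -/
lemma anhPot_step_le {R C r : ℝ} (hC : 0 ≤ C) (hRC : C = 0 → R ≤ 0) (hr : |r| ≤ 1) :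
    anhPot (R + r) (C + |r|) ≤ anhPot R C + anhW R C * r + 3 / 2 * (|r| / (C + 1)) := by
  have hmid := anhPot_midpoint_le hC hRC
  have hC1 : 0 < C + 1 := by linarith
  have e1 : 3 / (2 * (C + 1)) = 3 / 2 * (1 / (C + 1)) := by field_simp
  rw [e1] at hmid
  have e2 : |r| / (C + 1) = |r| * (1 / (C + 1)) := by ring
  rw [e2]
  unfold anhW
  have hm := mul_le_mul_of_nonneg_left hmid (abs_nonneg r)
  rcases le_total 0 r with h | h
  · have := anhPot_convexComb_le (R := R) (R' := R + 1) (C := C) (C' := C + 1) (abs_nonneg r) hr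
      hC hC1 hRC
    rw [abs_of_nonneg h] at *
    have e : (1 - r) * R + r * (R + 1) = R + r := by ring
    have e' : (1 - r) * C + r * (C + 1) = C + r := by ring
    rw [e, e'] at this
    nlinarith
  · have := anhPot_convexComb_le (R := R) (R' := R - 1) (C := C) (C' := C + 1) (abs_nonneg r) hr
      hC hC1 hRC
    rw [abs_of_nonpos h] at *
    have e : (1 - -r) * R + -r * (R - 1) = R + r := by ring
    have e' : (1 - -r) * C + -r * (C + 1) = C + -r := by ring
    rw [e, e'] at this
    nlinarith

lemma one_le_anhPot {R C : ℝ} (hC : 0 ≤ C) : 1 ≤ anhPot R C :=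
  Real.one_le_exp (by positivity)

lemma anhW_nonneg {R C : ℝ} (hC : 0 ≤ C) : 0 ≤ anhW R C := by
  have : anhPot (R - 1) (C + 1) ≤ anhPot (R + 1) (C + 1) := by
    unfold anhPot
    gcongr
    linarith
  unfold anhW
  linarith

lemma anhW_zero_zero_pos : 0 < anhW 0 0 := by
  have h1 : anhPot (0 - 1) (0 + 1) = 1 := by norm_num [anhPot]
  have h2 : 1 < anhPot (0 + 1) (0 + 1) := by norm_num [anhPot]
  exact div_pos (sub_pos.2 (h1.trans_lt h2)) two_pos

lemma ConvexOn.sub_le_inner_gradient {E : Type*} [NormedAddCommGroup E] [InnerProductSpace ℝ E]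
    [CompleteSpace E] {f : E → ℝ} (hf : ConvexOn ℝ Set.univ f) {x : E}
    (hd : DifferentiableAt ℝ f x) (z : E) :
    f x - f z ≤ inner ℝ (gradient f x) (x - z) := by
  have hg : ConvexOn ℝ Set.univ (fun s : ℝ => f (AffineMap.lineMap x z s)) :=
    hf.comp_affineMap (AffineMap.lineMap x z)
  have hderiv : HasDerivAt (fun s : ℝ => f (AffineMap.lineMap x z s)) (fderiv ℝ f x (z - x)) 0 := by
    have h1 : HasDerivAt (fun s : ℝ => AffineMap.lineMap x z s) (z - x) (0 : ℝ) :=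
      AffineMap.hasDerivAt_lineMap
    have h2 : HasFDerivAt f (fderiv ℝ f x) (AffineMap.lineMap x z (0 : ℝ)) := by
      simpa using hd.hasFDerivAt
    exact h2.comp_hasDerivAt (0 : ℝ) h1
  have := hg.le_slope_of_hasDerivAt (Set.mem_univ 0) (Set.mem_univ 1) zero_lt_one hderiv
  simp [slope_def_field] at this
  rw [gradient, InnerProductSpace.toDual_symm_apply, map_sub]
  linarith

lemma norm_proj_sub_le {E : Type*} [NormedAddCommGroup E] [InnerProductSpace ℝ E]
    {Ω : Set E} (hconv : Convex ℝ Ω) {p z : E} (hp : p ∈ Ω)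
    (hmin : ∀ z' ∈ Ω, ‖p - z‖ ≤ ‖z' - z‖) {v : E} (hv : v ∈ Ω) :
    ‖p - v‖ ≤ ‖z - v‖ := by
  have hinf : ‖z - p‖ = ⨅ v : Ω, ‖z - v‖ := by
    have : Nonempty Ω := ⟨⟨p, hp⟩⟩
    apply le_antisymm
    · refine le_ciInf fun v => ?_
      rw [norm_sub_rev z p, norm_sub_rev z]
      exact hmin v v.2
    · exact ciInf_le ⟨0, by rintro _ ⟨v, rfl⟩; exact norm_nonneg _⟩ (⟨p, hp⟩ : Ω)
  have hin := (norm_eq_iInf_iff_real_inner_le_zero hconv hp).1 hinf v hv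
  have e : z - v = (z - p) - (v - p) := by abel
  have h2 : ‖z - v‖ ^ 2 = ‖z - p‖ ^ 2 - 2 * inner ℝ (z - p) (v - p) + ‖v - p‖ ^ 2 := by
    rw [e, norm_sub_sq_real]
  rw [norm_sub_rev p v]
  apply le_of_sq_le_sq _ (norm_nonneg _)
  nlinarith [sq_nonneg ‖z - p‖]

/-- Dynamic regret of projected gradient descent with constant step size, in linearised form. -/
lemma ogd_linear_dynamic_regret {E : Type*} [NormedAddCommGroup E] [InnerProductSpace ℝ E]
    {D G η : ℝ} (hη : 0 < η) (x u g : ℕ → E) (n : ℕ)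
    (hxu : ∀ t ≤ n, ∀ s ≤ n, ‖x t - u s‖ ≤ D) (hg : ∀ t ≤ n, ‖g t‖ ≤ G)
    (hstep : ∀ t < n, ‖x (t + 1) - u t‖ ≤ ‖x t - η • g t - u t‖) :
    ∑ t ∈ Finset.range (n + 1), inner ℝ (g t) (x t - u t) ≤
      D ^ 2 / (2 * η) + D / η * ∑ t ∈ Finset.range n, ‖u (t + 1) - u t‖ +
        η * (n + 1 : ℕ) * G ^ 2 / 2 := by
  have expand : ∀ t, ‖x t - η • g t - u t‖ ^ 2 =
      ‖x t - u t‖ ^ 2 - 2 * η * inner ℝ (g t) (x t - u t) + η ^ 2 * ‖g t‖ ^ 2 := by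
    intro t
    have e : x t - η • g t - u t = (x t - u t) - η • g t := by abel
    rw [e, norm_sub_sq_real, inner_smul_right, norm_smul, mul_pow, Real.norm_eq_abs, sq_abs,
      real_inner_comm]
    ring
  have main : ∀ m ≤ n, 2 * η * ∑ t ∈ Finset.range (m + 1), inner ℝ (g t) (x t - u t) +
      ‖x m - η • g m - u m‖ ^ 2 ≤
      D ^ 2 + 2 * D * ∑ t ∈ Finset.range m, ‖u (t + 1) - u t‖ + η ^ 2 * (m + 1 : ℕ) * G ^ 2 := by
    intro m
    induction m with
    | zero =>
      intro _
      have h1 := pow_le_pow_left₀ (norm_nonneg _) (hxu 0 (Nat.zero_le n) 0 (Nat.zero_le n)) 2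
      have h2 := mul_le_mul_of_nonneg_left
        (pow_le_pow_left₀ (norm_nonneg _) (hg 0 (Nat.zero_le n)) 2) (sq_nonneg η)
      rw [expand]
      simp
      linarith
    | succ m ih =>
      intro hm
      have ih := ih (by omega)
      rw [Finset.sum_range_succ _ (m + 1), expand (m + 1),
        Finset.sum_range_succ (fun t => ‖u (t + 1) - u t‖) m]
      have h2 := mul_le_mul_of_nonneg_left
        (pow_le_pow_left₀ (norm_nonneg _) (hg (m + 1) hm) 2) (sq_nonneg η)
      have h3 := pow_le_pow_left₀ (norm_nonneg _) (hstep m (by omega)) 2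
      have h4 : ‖x (m + 1) - u (m + 1)‖ ^ 2 ≤
          ‖x (m + 1) - u m‖ ^ 2 + 2 * D * ‖u (m + 1) - u m‖ := by
        have a := hxu (m + 1) hm (m + 1) hm
        have b := hxu (m + 1) hm m (by omega)
        have c : ‖x (m + 1) - u (m + 1)‖ ≤ ‖x (m + 1) - u m‖ + ‖u (m + 1) - u m‖ := by
          have e : x (m + 1) - u (m + 1) = (x (m + 1) - u m) - (u (m + 1) - u m) := by abel
          rw [e]
          exact norm_sub_le _ _
        nlinarith [norm_nonneg (x (m + 1) - u (m + 1)), norm_nonneg (x (m + 1) - u m),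
          norm_nonneg (u (m + 1) - u m)]
      push_cast at ih ⊢
      linarith
  have h := main n le_rfl
  have h' : 2 * η * ∑ t ∈ Finset.range (n + 1), inner ℝ (g t) (x t - u t) ≤
      D ^ 2 + 2 * D * ∑ t ∈ Finset.range n, ‖u (t + 1) - u t‖ + η ^ 2 * (n + 1 : ℕ) * G ^ 2 := by
    linarith [sq_nonneg ‖x n - η • g n - u n‖]
  rw [mul_comm, ← le_div_iff₀ (by positivity)] at h'
  refine h'.trans (le_of_eq ?_)
  field_simp

/-- Hoeffding's lemma for a finitely supported distribution of losses in `[0, 1]`. -/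
lemma sum_mul_exp_neg_le {s : Finset ℕ} {p ℓ : ℕ → ℝ} (hp : ∀ j ∈ s, 0 ≤ p j)
    (hsum : ∑ j ∈ s, p j = 1) (hℓ : ∀ j ∈ s, ℓ j ∈ Set.Icc (0 : ℝ) 1) (α : ℝ) :
    ∑ j ∈ s, p j * Real.exp (-α * ℓ j) ≤
      Real.exp (-α * ∑ j ∈ s, p j * ℓ j + α ^ 2 / 8) := by
  classical
  let μ : MeasureTheory.Measure ℕ := ∑ j ∈ s, ENNReal.ofReal (p j) • MeasureTheory.Measure.dirac j
  have hint : ∀ h : ℕ → ℝ, ∫ a, h a ∂μ = ∑ j ∈ s, p j * h j := by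
    intro h
    rw [MeasureTheory.integral_finsetSum_measure]
    · refine Finset.sum_congr rfl fun j hj => ?_
      rw [MeasureTheory.integral_smul_measure, MeasureTheory.integral_dirac,
        ENNReal.toReal_ofReal (hp j hj), smul_eq_mul]
    · intro j _
      exact (MeasureTheory.integrable_dirac (by simp)).smul_measure ENNReal.ofReal_ne_top
  have : MeasureTheory.IsProbabilityMeasure μ := ⟨by
    simp only [μ, MeasureTheory.Measure.finsetSum_apply, MeasureTheory.Measure.smul_apply,
      MeasureTheory.measure_univ, smul_eq_mul, mul_one]
    rw [← ENNReal.ofReal_sum_of_nonneg hp, hsum, ENNReal.ofReal_one]⟩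
  have hae : ∀ᵐ a ∂μ, ℓ a ∈ Set.Icc (0 : ℝ) 1 := by
    rw [MeasureTheory.ae_iff]
    simp only [μ, MeasureTheory.Measure.finsetSum_apply, MeasureTheory.Measure.smul_apply,
      smul_eq_mul]
    refine Finset.sum_eq_zero fun j hj => ?_
    rw [MeasureTheory.Measure.dirac_apply' _ (MeasurableSet.of_discrete)]
    rw [Set.indicator_of_notMem (by simpa using hℓ j hj), mul_zero]
  have h := (ProbabilityTheory.hasSubgaussianMGF_of_mem_Icc
    (measurable_of_countable ℓ).aemeasurable hae).mgf_le (-α)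
  rw [ProbabilityTheory.mgf, hint, hint] at h
  set m := ∑ j ∈ s, p j * ℓ j with hm
  rw [Real.exp_add]
  have e : ∑ j ∈ s, p j * Real.exp (-α * ℓ j) =
      Real.exp (-α * m) * ∑ j ∈ s, p j * Real.exp (-α * (ℓ j - m)) := by
    rw [Finset.mul_sum]
    refine Finset.sum_congr rfl fun j _ => ?_
    rw [mul_left_comm, ← Real.exp_add]
    ring_nf
  rw [e]
  refine mul_le_mul_of_nonneg_left (h.trans (le_of_eq ?_)) (Real.exp_pos _).le
  congr 1
  norm_num
  ring

lemma hedge_weights {s : Finset ℕ} {p ℓ : ℕ → ℕ → ℝ} {α : ℝ} {n : ℕ}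
    (h0 : ∀ j ∈ s, 0 < p 0 j) (hsum : ∑ j ∈ s, p 0 j = 1)
    (hup : ∀ t < n, ∀ j ∈ s, p (t + 1) j = p t j * Real.exp (-α * ℓ t j) /
      ∑ j' ∈ s, p t j' * Real.exp (-α * ℓ t j')) :
    ∀ t ≤ n, (∀ j ∈ s, 0 < p t j) ∧ ∑ j ∈ s, p t j = 1 := by
  have hs : s.Nonempty := by
    by_contra h
    rw [Finset.not_nonempty_iff_eq_empty.1 h] at hsum
    simp at hsum
  intro t
  induction t with
  | zero => exact fun _ => ⟨h0, hsum⟩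
  | succ t ih =>
    intro ht
    obtain ⟨hpos, -⟩ := ih (by omega)
    have hZ : 0 < ∑ j' ∈ s, p t j' * Real.exp (-α * ℓ t j') :=
      Finset.sum_pos (fun j hj => mul_pos (hpos j hj) (Real.exp_pos _)) hs
    refine ⟨fun j hj => ?_, ?_⟩
    · rw [hup t (by omega) j hj]
      exact div_pos (mul_pos (hpos j hj) (Real.exp_pos _)) hZ
    · rw [Finset.sum_congr rfl (hup t (by omega)), ← Finset.sum_div, div_self hZ.ne']

/-- Regret of Hedge with losses in `[0, 1]` against a single expert. -/
lemma hedge_regret {s : Finset ℕ} {p ℓ : ℕ → ℕ → ℝ} {α : ℝ} (hα : 0 < α) {n : ℕ}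
    (h0 : ∀ j ∈ s, 0 < p 0 j) (hsum : ∑ j ∈ s, p 0 j = 1)
    (hup : ∀ t < n, ∀ j ∈ s, p (t + 1) j = p t j * Real.exp (-α * ℓ t j) /
      ∑ j' ∈ s, p t j' * Real.exp (-α * ℓ t j'))
    (hℓ : ∀ t ≤ n, ∀ j ∈ s, ℓ t j ∈ Set.Icc (0 : ℝ) 1) {j : ℕ} (hj : j ∈ s) :
    ∑ t ∈ Finset.range (n + 1), ∑ j' ∈ s, p t j' * ℓ t j' ≤
      ∑ t ∈ Finset.range (n + 1), ℓ t j + Real.log (1 / p 0 j) / α + α * (n + 1 : ℕ) / 8 := by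
  have hw := hedge_weights h0 hsum hup
  have hterm : ∀ t ≤ n, Real.log (∑ j' ∈ s, p t j' * Real.exp (-α * ℓ t j')) ≤
      -α * ∑ j' ∈ s, p t j' * ℓ t j' + α ^ 2 / 8 := by
    intro t ht
    rw [Real.log_le_iff_le_exp (Finset.sum_pos
      (fun j hj => mul_pos ((hw t ht).1 j hj) (Real.exp_pos _)) ⟨j, hj⟩)]
    exact sum_mul_exp_neg_le (fun j hj => ((hw t ht).1 j hj).le) (hw t ht).2 (hℓ t ht) α
  have main : ∀ m ≤ n, α * ∑ t ∈ Finset.range m, ∑ j' ∈ s, p t j' * ℓ t j' ≤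
      α * ∑ t ∈ Finset.range m, ℓ t j + (Real.log (p m j) - Real.log (p 0 j)) + α ^ 2 * m / 8 := by
    intro m
    induction m with
    | zero => simp
    | succ m ih =>
      intro hm
      have ih := ih (by omega)
      have hZ : 0 < ∑ j' ∈ s, p m j' * Real.exp (-α * ℓ m j') := Finset.sum_pos
        (fun j hj => mul_pos ((hw m (by omega)).1 j hj) (Real.exp_pos _)) ⟨j, hj⟩
      have hp := (hw m (by omega)).1 j hj
      have h1 := hterm m (by omega)
      have h2 : Real.log (p (m + 1) j) = Real.log (p m j) - α * ℓ m j -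
          Real.log (∑ j' ∈ s, p m j' * Real.exp (-α * ℓ m j')) := by
        rw [hup m (by omega) j hj, Real.log_div (mul_pos hp (Real.exp_pos _)).ne' hZ.ne',
          Real.log_mul hp.ne' (Real.exp_pos _).ne', Real.log_exp]
        ring
      rw [Finset.sum_range_succ, Finset.sum_range_succ, h2]
      push_cast
      linarith
  have h1 := main n le_rfl
  have h2 : Real.log (p n j) - α * ℓ n j ≤
      Real.log (∑ j' ∈ s, p n j' * Real.exp (-α * ℓ n j')) := by
    have hp := (hw n le_rfl).1 j hj
    have h3 : p n j * Real.exp (-α * ℓ n j) ≤ ∑ j' ∈ s, p n j' * Real.exp (-α * ℓ n j') :=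
      Finset.single_le_sum (f := fun j' => p n j' * Real.exp (-α * ℓ n j'))
        (fun j hj => (mul_pos ((hw n le_rfl).1 j hj) (Real.exp_pos _)).le) hj
    have h4 := Real.log_le_log (mul_pos hp (Real.exp_pos _)) h3
    rw [Real.log_mul hp.ne' (Real.exp_pos _).ne', Real.log_exp] at h4
    linarith
  have h3 := hterm n le_rfl
  have h4 : α * ∑ t ∈ Finset.range (n + 1), ∑ j' ∈ s, p t j' * ℓ t j' ≤
      α * ∑ t ∈ Finset.range (n + 1), ℓ t j - Real.log (p 0 j) + α ^ 2 * (n + 1 : ℕ) / 8 := by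
    rw [Finset.sum_range_succ, Finset.sum_range_succ _ n]
    push_cast
    linarith
  rw [mul_comm, ← le_div_iff₀ hα] at h4
  refine h4.trans (le_of_eq ?_)
  rw [one_div, Real.log_inv]
  field_simp
  ring

lemma sum_one_div_mul_succ (N : ℕ) :
    ∑ j ∈ Finset.Icc 1 N, 1 / ((j : ℝ) * ((j : ℝ) + 1)) = 1 - 1 / ((N : ℝ) + 1) := by
  induction N with
  | zero => simp
  | succ N ih =>
    rw [Finset.sum_Icc_succ_top (by omega), ih]
    push_cast
    field_simp
    ring

lemma sum_ader_initial_weights {N : ℕ} (hN : 1 ≤ N) :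
    ∑ j ∈ Finset.Icc 1 N, (1 + 1 / (N : ℝ)) / ((j : ℝ) * ((j : ℝ) + 1)) = 1 := by
  have h : ∀ j : ℕ, (1 + 1 / (N : ℝ)) / ((j : ℝ) * ((j : ℝ) + 1)) =
      (1 + 1 / (N : ℝ)) * (1 / ((j : ℝ) * ((j : ℝ) + 1))) := fun j => by ring
  simp_rw [h]
  rw [← Finset.mul_sum, sum_one_div_mul_succ]
  have : (0 : ℝ) < N := by exact_mod_cast hN
  field_simp
  ring

lemma two_pow_floor_le_sqrt {x : ℝ} (hx : 1 ≤ x) :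
    2 ^ ⌊Real.logb 2 x / 2⌋₊ ≤ Real.sqrt x ∧ Real.sqrt x ≤ 2 * 2 ^ ⌊Real.logb 2 x / 2⌋₊ := by
  have hl : 0 ≤ Real.logb 2 x / 2 := by
    have := Real.logb_nonneg one_lt_two hx
    positivity
  have hs : Real.sqrt x = (2 : ℝ) ^ (Real.logb 2 x / 2) := by
    rw [div_eq_mul_inv, Real.rpow_mul two_pos.le, Real.rpow_logb two_pos (by norm_num)
      (by linarith), Real.sqrt_eq_rpow, one_div]
  rw [hs, ← pow_succ', ← Real.rpow_natCast, ← Real.rpow_natCast]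
  constructor
  · exact Real.rpow_le_rpow_of_exponent_le one_le_two (Nat.floor_le hl)
  · apply Real.rpow_le_rpow_of_exponent_le one_le_two
    push_cast
    exact (Nat.lt_floor_add_one _).le

/-- The step size `η` within a factor two of the optimal one loses at most a factor `3/2`. -/
lemma ogd_bound_le {D G P η c : ℝ} {m : ℕ} (hm : 1 ≤ m) (hD : 0 < D) (hG : 0 < G)
    (hc : c ^ 2 = 1 + 4 * P / (7 * D)) {e : ℝ}
    (he : e = D / G * Real.sqrt (7 / (2 * (m : ℝ))) * c) (hη : 0 < η) (h1 : η ≤ e)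
    (h2 : e ≤ 2 * η) :
    D ^ 2 / (2 * η) + D / η * P + η * m * G ^ 2 / 2 ≤
      3 * G / 4 * Real.sqrt (2 * m * (7 * D ^ 2 + 4 * D * P)) := by
  have hm0 : (0 : ℝ) < m := by exact_mod_cast hm
  have he0 : 0 < e := hη.trans_le h1
  have he2 : 7 * D ^ 2 + 4 * D * P = 2 * m * G ^ 2 * e ^ 2 := by
    rw [he, mul_pow, mul_pow, Real.sq_sqrt (by positivity), hc]
    field_simp
  have hs : Real.sqrt (2 * m * (7 * D ^ 2 + 4 * D * P)) = 2 * m * G * e := by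
    rw [he2, show 2 * (m : ℝ) * (2 * m * G ^ 2 * e ^ 2) = (2 * m * G * e) ^ 2 by ring]
    exact Real.sqrt_sq (by positivity)
  rw [hs]
  have h3 : D ^ 2 / (2 * η) + D / η * P ≤ m * G ^ 2 * e := by
    have e1 : D ^ 2 / (2 * η) + D / η * P = (2 * D ^ 2 + 4 * D * P) / (4 * η) := by
      field_simp
      ring
    rw [e1, div_le_iff₀ (by positivity)]
    have : m * G ^ 2 * e * e ≤ m * G ^ 2 * e * (2 * η) :=
      mul_le_mul_of_nonneg_left h2 (by positivity)
    nlinarith [sq_nonneg D]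
  have h4 : η * m * G ^ 2 ≤ e * m * G ^ 2 := by gcongr
  nlinarith

lemma log_term_le {m N j : ℕ} (hm : 1 ≤ m) (hN : 1 ≤ N) (hj : 1 ≤ j) :
    Real.log (1 / ((1 + 1 / (N : ℝ)) / ((j : ℝ) * ((j : ℝ) + 1)))) / aderAlpha m +
        aderAlpha m * m / 8 ≤
      Real.sqrt (2 * m) / 4 * (1 + 2 * Real.log ((j : ℝ) + 1)) := by
  have hm0 : (0 : ℝ) < m := by exact_mod_cast hm
  have hN0 : (0 : ℝ) < N := by exact_mod_cast hN
  have hj0 : (0 : ℝ) < j := by exact_mod_cast hj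
  set s := Real.sqrt (2 * m) / 4 with hs
  have hs0 : 0 < s := by positivity
  have hα : 0 < aderAlpha m := Real.sqrt_pos.2 (by positivity)
  have h1 : aderAlpha m * s = 1 := by
    rw [hs, aderAlpha, ← mul_div_assoc, ← Real.sqrt_mul (by positivity),
      show 8 / (m : ℝ) * (2 * m) = 4 ^ 2 by field_simp; norm_num, Real.sqrt_sq (by norm_num)]
    norm_num
  have h2 : s ^ 2 = m / 8 := by
    rw [hs, div_pow, Real.sq_sqrt (by positivity)]
    ring
  have h3 : aderAlpha m * m / 8 = s := by
    calc aderAlpha m * m / 8 = aderAlpha m * s * s := by rw [mul_assoc, ← sq, h2]; ring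
      _ = s := by rw [h1, one_mul]
  have h4 : Real.log (1 / ((1 + 1 / (N : ℝ)) / ((j : ℝ) * ((j : ℝ) + 1)))) ≤
      2 * Real.log ((j : ℝ) + 1) := by
    have : 2 * Real.log ((j : ℝ) + 1) = Real.log (((j : ℝ) + 1) ^ 2) := by
      rw [Real.log_pow]; norm_num
    rw [this]
    apply Real.log_le_log (by positivity)
    rw [one_div_div, div_le_iff₀ (by positivity)]
    have : 0 ≤ 1 / (N : ℝ) := by positivity
    nlinarith [mul_nonneg this (sq_nonneg ((j : ℝ) + 1))]
  have h5 : 1 / aderAlpha m = s := by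
    rw [div_eq_iff hα.ne', mul_comm, h1]
  rw [h3, div_eq_mul_one_div, h5]
  nlinarith

lemma ader_initial_weights {m : ℕ} {p : ℕ → ℕ → ℝ}
    (hp0 : ∀ j, 1 ≤ j → j ≤ aderN m →
      p 0 j = (1 + 1 / (aderN m : ℝ)) / ((j : ℝ) * ((j : ℝ) + 1))) :
    (∀ j ∈ Finset.Icc 1 (aderN m), 0 < p 0 j) ∧ ∑ j ∈ Finset.Icc 1 (aderN m), p 0 j = 1 := by
  have hN : 1 ≤ aderN m := Nat.le_add_left _ _
  have hp0' : ∀ j ∈ Finset.Icc 1 (aderN m),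
      p 0 j = (1 + 1 / (aderN m : ℝ)) / ((j : ℝ) * ((j : ℝ) + 1)) := fun j hj =>
    hp0 j (Finset.mem_Icc.1 hj).1 (Finset.mem_Icc.1 hj).2
  refine ⟨fun j hj => ?_, by rw [Finset.sum_congr rfl hp0', sum_ader_initial_weights hN]⟩
  have : (0 : ℝ) < j := by exact_mod_cast (Finset.mem_Icc.1 hj).1
  rw [hp0' j hj]
  positivity

/-- Dynamic regret of Ader over its whole horizon `m`. -/
lemma ader_dynamic_regret {E : Type*} [NormedAddCommGroup E] [InnerProductSpace ℝ E]
    [CompleteSpace E] {Ω : Set E} (hconv : Convex ℝ Ω) {D G : ℝ}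
    (hdiam : ∀ z ∈ Ω, ∀ z' ∈ Ω, ‖z - z'‖ ≤ D)
    {F : ℕ → E → ℝ} (hFconv : ∀ t, ConvexOn ℝ Set.univ (F t))
    (hFdiff : ∀ t z, DifferentiableAt ℝ (F t) z)
    (hgrad : ∀ t, ∀ z ∈ Ω, ‖gradient (F t) z‖ ≤ G)
    (hrange : ∀ t, ∀ z ∈ Ω, 0 ≤ F t z ∧ F t z ≤ 1)
    {proj : E → E} (hproj : ∀ z, proj z ∈ Ω ∧ ∀ z' ∈ Ω, ‖proj z - z‖ ≤ ‖z' - z‖)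
    {n : ℕ} {x : ℕ → ℕ → E} {p : ℕ → ℕ → ℝ}
    (hx0 : ∀ j, x j 0 ∈ Ω)
    (hxup : ∀ j, ∀ t < n,
      x j (t + 1) = proj (x j t - aderEta D G (n + 1) j • gradient (F t) (x j t)))
    (hp0 : ∀ j, 1 ≤ j → j ≤ aderN (n + 1) →
      p 0 j = (1 + 1 / (aderN (n + 1) : ℝ)) / ((j : ℝ) * ((j : ℝ) + 1)))
    (hpup : ∀ t < n, ∀ j, p (t + 1) j = p t j * Real.exp (-aderAlpha (n + 1) * F t (x j t)) /
      ∑ j' ∈ Finset.Icc 1 (aderN (n + 1)),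
        p t j' * Real.exp (-aderAlpha (n + 1) * F t (x j' t)))
    {u : ℕ → E} (hu : ∀ t ≤ n, u t ∈ Ω) {P : ℝ}
    (hP : P = ∑ t ∈ Finset.range n, ‖u (t + 1) - u t‖) :
    (∀ t ≤ n, ∑ j ∈ Finset.Icc 1 (aderN (n + 1)), p t j • x j t ∈ Ω) ∧
    ∑ t ∈ Finset.range (n + 1),
        (F t (∑ j ∈ Finset.Icc 1 (aderN (n + 1)), p t j • x j t) - F t (u t)) ≤
      3 * G / 4 * Real.sqrt (2 * ((n + 1 : ℕ) : ℝ) * (7 * D ^ 2 + 4 * D * P)) +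
      Real.sqrt (2 * ((n + 1 : ℕ) : ℝ)) / 4 *
        (1 + 2 * Real.log (((⌊Real.logb 2 (1 + 4 * P / (7 * D)) / 2⌋₊ + 1 : ℕ) : ℝ) + 1)) := by
  have hx : ∀ j, ∀ t ≤ n, x j t ∈ Ω := by
    intro j t ht
    cases t with
    | zero => exact hx0 j
    | succ t =>
      rw [hxup j t (by omega)]
      exact (hproj _).1
  obtain ⟨hpos, hsum⟩ := ader_initial_weights hp0
  have hw := hedge_weights hpos hsum (ℓ := fun t j => F t (x j t)) fun t ht j _ => hpup t ht j
  have hmem : ∀ t ≤ n, ∑ j ∈ Finset.Icc 1 (aderN (n + 1)), p t j • x j t ∈ Ω := fun t ht =>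
    hconv.sum_mem (fun j hj => ((hw t ht).1 j hj).le) (hw t ht).2 fun j _ => hx j t ht
  refine ⟨hmem, ?_⟩
  have hG : 0 ≤ G := (norm_nonneg _).trans (hgrad 0 _ (hx0 0))
  have hD : 0 ≤ D := (norm_nonneg _).trans (hdiam _ (hx0 0) _ (hx0 0))
  by_cases hDG : D = 0 ∨ G = 0
  · have hle : ∑ t ∈ Finset.range (n + 1),
        (F t (∑ j ∈ Finset.Icc 1 (aderN (n + 1)), p t j • x j t) - F t (u t)) ≤ 0 := by
      refine Finset.sum_nonpos fun t ht => ?_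
      have ht : t ≤ n := by simpa [Nat.lt_succ_iff] using ht
      refine ((hFconv t).sub_le_inner_gradient (hFdiff t _) (u t)).trans
        ((real_inner_le_norm _ _).trans ?_)
      have hGD : G * D = 0 := by rcases hDG with h | h <;> simp [h]
      rw [← hGD]
      exact mul_le_mul (hgrad t _ (hmem t ht)) (hdiam _ (hmem t ht) _ (hu t ht)) (norm_nonneg _) hG
    have hlog : 0 ≤ Real.log
        (((⌊Real.logb 2 (1 + 4 * P / (7 * D)) / 2⌋₊ + 1 : ℕ) : ℝ) + 1) :=
      Real.log_nonneg (le_add_of_nonneg_left (Nat.cast_nonneg _))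
    exact hle.trans (by positivity)
  · push Not at hDG
    have hD : 0 < D := lt_of_le_of_ne hD hDG.1.symm
    have hG : 0 < G := lt_of_le_of_ne hG hDG.2.symm
    have hP0 : 0 ≤ P := by rw [hP]; exact Finset.sum_nonneg fun _ _ => norm_nonneg _
    have hPle : P ≤ (n + 1 : ℕ) * D := by
      rw [hP]
      calc ∑ t ∈ Finset.range n, ‖u (t + 1) - u t‖ ≤ ∑ t ∈ Finset.range n, D := by
            refine Finset.sum_le_sum fun t ht => ?_
            have := Finset.mem_range.1 ht
            exact hdiam _ (hu _ (by omega)) _ (hu _ (by omega))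
        _ = n * D := by simp
        _ ≤ (n + 1 : ℕ) * D := by gcongr; omega
    have hx1 : 1 ≤ 1 + 4 * P / (7 * D) := le_add_of_nonneg_right (by positivity)
    set k := ⌊Real.logb 2 (1 + 4 * P / (7 * D)) / 2⌋₊ with hk
    obtain ⟨hk1, hk2⟩ := two_pow_floor_le_sqrt hx1
    rw [← hk] at hk1 hk2
    have hkN : k + 1 ∈ Finset.Icc 1 (aderN (n + 1)) := by
      refine Finset.mem_Icc.2 ⟨by omega, ?_⟩
      refine Nat.succ_le_succ ((Nat.floor_mono ?_).trans (Nat.floor_le_ceil _))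
      gcongr ?_ / 2
      refine Real.logb_le_logb_of_le one_lt_two (by linarith) ?_
      gcongr 1 + ?_
      rw [div_le_div_iff₀ (by positivity) (by norm_num)]
      nlinarith
    set b := D / G * Real.sqrt (7 / (2 * ((n + 1 : ℕ) : ℝ))) with hb
    have hb0 : 0 < b := by positivity
    have hη : aderEta D G (n + 1) (k + 1) = 2 ^ k * b := by
      simp only [aderEta, hb, Nat.add_sub_cancel]
      ring
    have hη0 : 0 < aderEta D G (n + 1) (k + 1) := by rw [hη]; positivity
    have hogd := ogd_linear_dynamic_regret (D := D) (G := G) hη0 (x (k + 1)) u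
      (fun t => gradient (F t) (x (k + 1) t)) n
      (fun t ht s hs => hdiam _ (hx _ t ht) _ (hu s hs))
      (fun t ht => hgrad t _ (hx _ t ht)) (fun t ht => by
        rw [hxup _ t ht]
        exact norm_proj_sub_le hconv (hproj _).1 (hproj _).2 (hu t ht.le))
    rw [← hP] at hogd
    have hopt := ogd_bound_le (m := n + 1) (P := P) (by omega) hD hG
      (Real.sq_sqrt (by linarith)) rfl hη0
      (by rw [hη, ← hb]; nlinarith)
      (by rw [hη, ← hb]; nlinarith)
    have hhedge := hedge_regret (α := aderAlpha (n + 1)) (Real.sqrt_pos.2 (by positivity))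
      hpos hsum (ℓ := fun t j => F t (x j t)) (fun t ht j _ => hpup t ht j)
      (fun t ht j _ => hrange t _ (hx j t ht)) hkN
    rw [hp0 _ (Finset.mem_Icc.1 hkN).1 (Finset.mem_Icc.1 hkN).2] at hhedge
    have hlog := log_term_le (m := n + 1) (N := aderN (n + 1)) (j := k + 1) (by omega)
      (Nat.le_add_left _ _) (by omega)
    have hjensen : ∑ t ∈ Finset.range (n + 1),
        F t (∑ j ∈ Finset.Icc 1 (aderN (n + 1)), p t j • x j t) ≤
        ∑ t ∈ Finset.range (n + 1), ∑ j ∈ Finset.Icc 1 (aderN (n + 1)), p t j * F t (x j t) := by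
      refine Finset.sum_le_sum fun t ht => ?_
      have ht : t ≤ n := by simpa [Nat.lt_succ_iff] using ht
      exact (hFconv t).map_sum_le (fun j hj => ((hw t ht).1 j hj).le) (hw t ht).2
        fun _ _ => Set.mem_univ _
    have hlin : ∑ t ∈ Finset.range (n + 1), (F t (x (k + 1) t) - F t (u t)) ≤
        ∑ t ∈ Finset.range (n + 1),
          inner ℝ (gradient (F t) (x (k + 1) t)) (x (k + 1) t - u t) :=
      Finset.sum_le_sum fun t _ => (hFconv t).sub_le_inner_gradient (hFdiff t _) (u t)
    rw [Finset.sum_sub_distrib] at hlin ⊢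
    linarith

/-- An upper bound for the cumulative error terms `|r_t| / (C_{t-1} + 1)`, as a function of the
current value of `C`. -/
noncomputable def anhErr (C : ℝ) : ℝ := 1 - 1 / (1 + C) + Real.log (1 + C)

lemma div_le_anhErr_sub {C a : ℝ} (hC : 0 ≤ C) (ha : 0 ≤ a) (ha1 : a ≤ 1) :
    a / (C + 1) ≤ anhErr (C + a) - anhErr C := by
  have h1 : 0 < 1 + C := by linarith
  have h2 : 0 < 1 + (C + a) := by linarith
  have hlog : a / (1 + (C + a)) ≤ Real.log (1 + (C + a)) - Real.log (1 + C) := by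
    have := Real.one_sub_inv_le_log_of_pos (div_pos h2 h1)
    rw [Real.log_div h2.ne' h1.ne'] at this
    refine le_trans (le_of_eq ?_) this
    field_simp
    ring
  have hdiff : a / (C + 1) - a / (1 + (C + a)) ≤ 1 / (1 + C) - 1 / (1 + (C + a)) := by
    have e1 : a / (C + 1) - a / (1 + (C + a)) = a * a / ((1 + C) * (1 + (C + a))) := by
      field_simp
      ring
    have e2 : 1 / (1 + C) - 1 / (1 + (C + a)) = a / ((1 + C) * (1 + (C + a))) := by
      field_simp
      ring
    rw [e1, e2]
    gcongr
    nlinarith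
  unfold anhErr
  linarith

lemma anhErr_le {C T : ℝ} (hC : 0 ≤ C) (hCT : C ≤ T) : anhErr C ≤ 1 + Real.log (1 + T) := by
  have h1 : 0 ≤ 1 / (1 + C) := by positivity
  have h2 : Real.log (1 + C) ≤ Real.log (1 + T) := Real.log_le_log (by linarith) (by linarith)
  unfold anhErr
  linarith

/-- The AdaNormalHedge potential compensated for its accumulated errors. -/
noncomputable def anhCompPot (R C : ℝ) : ℝ := anhPot R C - 3 / 2 * anhErr C

lemma anhCompPot_step_le {R C r : ℝ} (hC : 0 ≤ C) (hRC : C = 0 → R ≤ 0) (hr : |r| ≤ 1) :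
    anhCompPot (R + r) (C + |r|) ≤ anhCompPot R C + anhW R C * r := by
  have h1 := anhPot_step_le hC hRC hr
  have h2 := div_le_anhErr_sub hC (abs_nonneg r) hr
  unfold anhCompPot
  linarith

lemma anhCompPot_zero_zero : anhCompPot 0 0 = 1 := by
  simp [anhCompPot, anhPot, anhErr]

/-- The sum of `r k i` over the rounds of the `i`-th level-`k` interval preceding round `n`. -/
noncomputable def intervalSum (r : ℕ → ℕ → ℕ → ℝ) (k i n : ℕ) : ℝ :=
  ∑ u ∈ Finset.Ico (i * 2 ^ k) n, r k i u

lemma mem_gcLevels {t k : ℕ} : k ∈ gcLevels t ↔ 2 ^ k ≤ t := by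
  unfold gcLevels
  simp only [Finset.mem_filter, Finset.mem_range, and_iff_right_iff_imp]
  intro h
  have := Nat.lt_two_pow_self (n := k)
  omega

lemma card_gcLevels_le {t T : ℕ} (hT : t ≤ T) :
    ((gcLevels t).card : ℝ) ≤ 1 + Real.logb 2 T := by
  have hsub : gcLevels t ⊆ Finset.range (Nat.log 2 T + 1) := by
    intro k hk
    rw [mem_gcLevels] at hk
    have hpos := Nat.two_pow_pos k
    exact Finset.mem_range.2 (Nat.lt_succ_of_le
      ((Nat.le_log_iff_pow_le one_lt_two (by omega)).2 (hk.trans hT)))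
  have h1 := Finset.card_le_card hsub
  rw [Finset.card_range] at h1
  calc ((gcLevels t).card : ℝ) ≤ (Nat.log 2 T + 1 : ℕ) := by exact_mod_cast h1
    _ = 1 + (Nat.log 2 T : ℝ) := by push_cast; ring
    _ ≤ 1 + Real.logb 2 T := by
      gcongr
      exact_mod_cast Real.natLog_le_logb T 2

lemma intervalSum_abs_nonneg (r : ℕ → ℕ → ℕ → ℝ) (k i n : ℕ) :
    0 ≤ intervalSum (fun k i u => |r k i u|) k i n :=
  Finset.sum_nonneg fun _ _ => abs_nonneg _

lemma intervalSum_le_abs (r : ℕ → ℕ → ℕ → ℝ) (k i n : ℕ) :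
    intervalSum r k i n ≤ intervalSum (fun k i u => |r k i u|) k i n :=
  Finset.sum_le_sum fun _ _ => le_abs_self _

lemma intervalSum_abs_le {r : ℕ → ℕ → ℕ → ℝ}
    (hr : ∀ k i u, 1 ≤ i → i * 2 ^ k ≤ u → u < (i + 1) * 2 ^ k → |r k i u| ≤ 1)
    {k i n : ℕ} (hi : 1 ≤ i) (hn : n ≤ (i + 1) * 2 ^ k) :
    intervalSum (fun k i u => |r k i u|) k i n ≤ ((n - i * 2 ^ k : ℕ) : ℝ) := by
  calc intervalSum (fun k i u => |r k i u|) k i n ≤ ∑ u ∈ Finset.Ico (i * 2 ^ k) n, (1 : ℝ) :=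
        Finset.sum_le_sum fun u hu => by
          obtain ⟨h1, h2⟩ := Finset.mem_Ico.1 hu
          exact hr k i u hi h1 (by omega)
    _ = _ := by simp

lemma sum_anhCompPot_le {r : ℕ → ℕ → ℕ → ℝ}
    (hr : ∀ k i u, 1 ≤ i → i * 2 ^ k ≤ u → u < (i + 1) * 2 ^ k → |r k i u| ≤ 1)
    (hsum : ∀ t, 1 ≤ t → ∑ k ∈ gcLevels t, anhW (intervalSum r k (t / 2 ^ k) t)
      (intervalSum (fun k i u => |r k i u|) k (t / 2 ^ k) t) * r k (t / 2 ^ k) t ≤ 0)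
    {T : ℕ} {M : ℝ} (hM : M = 3 / 2 * (1 + Real.log (1 + (T : ℝ)))) :
    ∀ t ≤ T, (∀ k ∈ gcLevels t, 0 ≤ anhCompPot (intervalSum r k (t / 2 ^ k) (t + 1))
        (intervalSum (fun k i u => |r k i u|) k (t / 2 ^ k) (t + 1)) + M) ∧
      ∑ k ∈ gcLevels t, (anhCompPot (intervalSum r k (t / 2 ^ k) (t + 1))
        (intervalSum (fun k i u => |r k i u|) k (t / 2 ^ k) (t + 1)) + M) ≤
      t * (1 + Real.logb 2 T) * (1 + M) := by
  have hM0 : 0 ≤ M := by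
    have : 0 ≤ Real.log (1 + (T : ℝ)) :=
      Real.log_nonneg (le_add_of_nonneg_right (Nat.cast_nonneg _))
    rw [hM]
    positivity
  have hidx : ∀ t k, 2 ^ k ≤ t → 1 ≤ t / 2 ^ k ∧ t / 2 ^ k * 2 ^ k ≤ t ∧
      t < (t / 2 ^ k + 1) * 2 ^ k := fun t k h =>
    ⟨(Nat.one_le_div_iff (Nat.two_pow_pos k)).2 h, Nat.div_mul_le_self _ _,
      Nat.lt_mul_of_div_lt (Nat.lt_succ_self _) (Nat.two_pow_pos k)⟩
  have hnonneg : ∀ t ≤ T, ∀ k ∈ gcLevels t,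
      0 ≤ anhCompPot (intervalSum r k (t / 2 ^ k) (t + 1))
        (intervalSum (fun k i u => |r k i u|) k (t / 2 ^ k) (t + 1)) + M := by
    intro t ht k hk
    obtain ⟨h1, h2, h3⟩ := hidx t k (mem_gcLevels.1 hk)
    have hC0 := intervalSum_abs_nonneg r k (t / 2 ^ k) (t + 1)
    have hC := intervalSum_abs_le hr (k := k) (n := t + 1) h1 h3
    have hle : ((t + 1 - t / 2 ^ k * 2 ^ k : ℕ) : ℝ) ≤ T := by
      have : 1 ≤ t / 2 ^ k * 2 ^ k := Nat.mul_pos h1 (Nat.two_pow_pos k)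
      exact_mod_cast (by omega : t + 1 - t / 2 ^ k * 2 ^ k ≤ T)
    have h4 := anhErr_le hC0 (hC.trans hle)
    have h5 := one_le_anhPot (R := intervalSum r k (t / 2 ^ k) (t + 1)) hC0
    unfold anhCompPot
    linarith
  intro t ht
  refine ⟨hnonneg t ht, ?_⟩
  induction t with
  | zero => simp [gcLevels]
  | succ t ih =>
    have ih := ih (by omega)
    have hstep : ∀ k ∈ gcLevels (t + 1),
        anhCompPot (intervalSum r k ((t + 1) / 2 ^ k) (t + 1 + 1))
          (intervalSum (fun k i u => |r k i u|) k ((t + 1) / 2 ^ k) (t + 1 + 1)) + M ≤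
        (anhCompPot (intervalSum r k ((t + 1) / 2 ^ k) (t + 1))
          (intervalSum (fun k i u => |r k i u|) k ((t + 1) / 2 ^ k) (t + 1)) + M) +
        anhW (intervalSum r k ((t + 1) / 2 ^ k) (t + 1))
          (intervalSum (fun k i u => |r k i u|) k ((t + 1) / 2 ^ k) (t + 1)) *
          r k ((t + 1) / 2 ^ k) (t + 1) := by
      intro k hk
      obtain ⟨h1, h2, h3⟩ := hidx (t + 1) k (mem_gcLevels.1 hk)
      have := anhCompPot_step_le (intervalSum_abs_nonneg r k ((t + 1) / 2 ^ k) (t + 1))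
        (fun h => (intervalSum_le_abs r k ((t + 1) / 2 ^ k) (t + 1)).trans h.le)
        (hr k ((t + 1) / 2 ^ k) (t + 1) h1 h2 h3)
      have e : ∀ r' : ℕ → ℕ → ℕ → ℝ, intervalSum r' k ((t + 1) / 2 ^ k) (t + 1 + 1) =
          intervalSum r' k ((t + 1) / 2 ^ k) (t + 1) + r' k ((t + 1) / 2 ^ k) (t + 1) :=
        fun r' => Finset.sum_Ico_succ_top h2 _
      rw [e, e]
      linarith
    have hbefore : ∀ k ∈ gcLevels (t + 1),
        anhCompPot (intervalSum r k ((t + 1) / 2 ^ k) (t + 1))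
          (intervalSum (fun k i u => |r k i u|) k ((t + 1) / 2 ^ k) (t + 1)) + M ≤
        (1 + M) + if k ∈ gcLevels t then anhCompPot (intervalSum r k (t / 2 ^ k) (t + 1))
          (intervalSum (fun k i u => |r k i u|) k (t / 2 ^ k) (t + 1)) + M else 0 := by
      intro k hk
      have hk' := mem_gcLevels.1 hk
      by_cases hdvd : 2 ^ k ∣ t + 1
      · have e : ∀ r' : ℕ → ℕ → ℕ → ℝ, intervalSum r' k ((t + 1) / 2 ^ k) (t + 1) = 0 := by
          intro r'
          simp [intervalSum, Nat.div_mul_cancel hdvd]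
        rw [e, e, anhCompPot_zero_zero]
        split_ifs with h
        · linarith [hnonneg t (by omega) k h]
        · linarith
      · have hmem : k ∈ gcLevels t := by
          rw [mem_gcLevels]
          rcases hk'.eq_or_lt with h | h
          · exact absurd h.dvd hdvd
          · omega
        rw [if_pos hmem, Nat.succ_div, if_neg hdvd, add_zero]
        linarith
    calc _ ≤ _ := Finset.sum_le_sum hstep
      _ ≤ ∑ k ∈ gcLevels (t + 1), (anhCompPot (intervalSum r k ((t + 1) / 2 ^ k) (t + 1))
          (intervalSum (fun k i u => |r k i u|) k ((t + 1) / 2 ^ k) (t + 1)) + M) := by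
        rw [Finset.sum_add_distrib]
        linarith [hsum (t + 1) (by omega)]
      _ ≤ _ := Finset.sum_le_sum hbefore
      _ = (gcLevels (t + 1)).card * (1 + M) + ∑ k ∈ gcLevels t,
          (anhCompPot (intervalSum r k (t / 2 ^ k) (t + 1))
          (intervalSum (fun k i u => |r k i u|) k (t / 2 ^ k) (t + 1)) + M) := by
        rw [Finset.sum_add_distrib, Finset.sum_const, nsmul_eq_mul, Finset.sum_ite_mem]
        congr 2
        refine Finset.inter_eq_right.2 fun k hk => ?_
        rw [mem_gcLevels] at hk ⊢
        omega
      _ ≤ (1 + Real.logb 2 T) * (1 + M) + t * (1 + Real.logb 2 T) * (1 + M) :=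
        add_le_add (mul_le_mul_of_nonneg_right (card_gcLevels_le ht) (by linarith)) ih
      _ = _ := by push_cast; ring

/-- Regret of AdaNormalHedge over the geometric covering intervals against the expert of a single
interval. -/
lemma intervalSum_le_sqrt {r : ℕ → ℕ → ℕ → ℝ}
    (hr : ∀ k i u, 1 ≤ i → i * 2 ^ k ≤ u → u < (i + 1) * 2 ^ k → |r k i u| ≤ 1)
    (hsum : ∀ t, 1 ≤ t → ∑ k ∈ gcLevels t, anhW (intervalSum r k (t / 2 ^ k) t)
      (intervalSum (fun k i u => |r k i u|) k (t / 2 ^ k) t) * r k (t / 2 ^ k) t ≤ 0)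
    {k t : ℕ} (ht : 2 ^ k ≤ t) :
    intervalSum r k (t / 2 ^ k) (t + 1) ≤ Real.sqrt (3 * 2 ^ k * cAOA t) := by
  set R := intervalSum r k (t / 2 ^ k) (t + 1) with hR
  set C := intervalSum (fun k i u => |r k i u|) k (t / 2 ^ k) (t + 1) with hC
  rcases le_or_gt R 0 with hR0 | hR0
  · exact hR0.trans (Real.sqrt_nonneg _)
  have hi : 1 ≤ t / 2 ^ k := (Nat.one_le_div_iff (Nat.two_pow_pos k)).2 ht
  have hlt : t < (t / 2 ^ k + 1) * 2 ^ k := Nat.lt_mul_of_div_lt (Nat.lt_succ_self _) (Nat.two_pow_pos k)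
  have hC0 : 0 < C := hR0.trans_le (intervalSum_le_abs r _ _ _)
  have hCle := intervalSum_abs_le hr (k := k) (n := t + 1) hi hlt
  have hlen : t + 1 - t / 2 ^ k * 2 ^ k ≤ 2 ^ k := by
    rw [Nat.sub_le_iff_le_add]
    linarith
  have hCk : C ≤ 2 ^ k := hCle.trans (by exact_mod_cast hlen)
  have hCt : C ≤ t := hCk.trans (by exact_mod_cast ht)
  have ht1 : (1 : ℝ) ≤ t := by
    have := (Nat.two_pow_pos k).trans_le ht
    exact_mod_cast this
  obtain ⟨hnn, hS⟩ := sum_anhCompPot_le hr hsum (T := t) rfl t le_rfl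
  have hone := (Finset.single_le_sum hnn (mem_gcLevels.2 ht)).trans hS
  have herr := anhErr_le hC0.le hCt
  have hpot : anhPot R C ≤
      t * (1 + Real.logb 2 t) * ((5 + 3 * Real.log (1 + (t : ℝ))) / 2) := by
    have e : 1 + 3 / 2 * (1 + Real.log (1 + (t : ℝ))) = (5 + 3 * Real.log (1 + (t : ℝ))) / 2 := by
      ring
    rw [e, ← hR, ← hC, anhCompPot] at hone
    linarith
  have hlogb : 0 ≤ Real.logb 2 t := Real.logb_nonneg one_lt_two ht1
  have hlog : 0 ≤ Real.log (1 + (t : ℝ)) := Real.log_nonneg (by linarith)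
  have hlogpot : R ^ 2 / (3 * C) ≤ cAOA t - 1 := by
    have h := Real.log_le_log (Real.exp_pos _) hpot
    rw [Real.log_exp, max_eq_left hR0.le, Real.log_mul (by positivity) (by positivity),
      Real.log_mul (by positivity) (by positivity)] at h
    unfold cAOA
    linarith
  apply Real.le_sqrt_of_sq_le
  rw [div_le_iff₀ (by positivity)] at hlogpot
  have hc : 0 ≤ cAOA t := by
    have : 0 ≤ (cAOA t - 1) * (3 * C) := (sq_nonneg R).trans hlogpot
    nlinarith
  nlinarith [mul_le_mul_of_nonneg_right hCk hc]

/-- Lemma 10, dynamic regret of AOA on covering intervals: under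
the AOA algorithm, for every interval `J = [i·2^k, (i+1)·2^k − 1] ∈ 𝓘` and every
comparator sequence `u` in `Ω` on `J` with local path-length `P_J`,
`Σ_{t∈J} (f_t(w_t) − f_t(u_t)) ≤ √(3|J|c'(max J)) + (3G/4)√(2|J|(7D² + 4DP_J))
  + (√(2|J|)/4)(1 + 2ln(k_J + 1))` with `k_J = ⌊(1/2)log₂(1 + 4P_J/(7D))⌋ + 1`. -/
theorem aoa_interval_dynamic_regret
    (d : ℕ) (D G : ℝ)
    (Ω : Set (EuclideanSpace ℝ (Fin d)))
    (hne : Ω.Nonempty) (hcomp : IsCompact Ω) (hconv : Convex ℝ Ω)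
    (hdiam : ∀ z ∈ Ω, ∀ z' ∈ Ω, ‖z - z'‖ ≤ D)
    (f : ℕ → EuclideanSpace ℝ (Fin d) → ℝ)
    (hfconv : ∀ t, ConvexOn ℝ Set.univ (f t))
    (hfdiff : ∀ t z, DifferentiableAt ℝ (f t) z)
    (hgrad : ∀ t, ∀ z ∈ Ω, ‖gradient (f t) z‖ ≤ G)
    (hrange : ∀ t, ∀ z ∈ Ω, 0 ≤ f t z ∧ f t z ≤ 1)
    (proj : EuclideanSpace ℝ (Fin d) → EuclideanSpace ℝ (Fin d))
    (hproj : ∀ z, proj z ∈ Ω ∧ ∀ z' ∈ Ω, ‖proj z - z‖ ≤ ‖z' - z‖)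
    (y : ℕ → ℕ → ℕ → ℕ → EuclideanSpace ℝ (Fin d))
    (q : ℕ → ℕ → ℕ → ℕ → ℝ)
    (wI : ℕ → ℕ → ℕ → EuclideanSpace ℝ (Fin d))
    (w : ℕ → EuclideanSpace ℝ (Fin d))
    (hy0 : ∀ k i j, y k i j (i * 2 ^ k) ∈ Ω)
    (hyup : ∀ k i j t, i * 2 ^ k ≤ t → t + 1 ≤ (i + 1) * 2 ^ k - 1 →
      y k i j (t + 1) = proj (y k i j t - aderEta D G (2 ^ k) j • gradient (f t) (y k i j t)))
    (hq0 : ∀ k i j, 1 ≤ j → j ≤ aderN (2 ^ k) →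
      q k i j (i * 2 ^ k) = (1 + 1 / (aderN (2 ^ k) : ℝ)) / ((j : ℝ) * ((j : ℝ) + 1)))
    (hqup : ∀ k i j t, i * 2 ^ k ≤ t → t + 1 ≤ (i + 1) * 2 ^ k - 1 →
      q k i j (t + 1) = q k i j t * Real.exp (-(aderAlpha (2 ^ k)) * f t (y k i j t)) /
        ∑ j' ∈ Finset.Icc 1 (aderN (2 ^ k)),
          q k i j' t * Real.exp (-(aderAlpha (2 ^ k)) * f t (y k i j' t)))
    (hwI : ∀ k i t, wI k i t = ∑ j ∈ Finset.Icc 1 (aderN (2 ^ k)), q k i j t • y k i j t)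
    (hw : ∀ t, 1 ≤ t → w t = ∑ k ∈ gcLevels t, aoaWeight f w wI k t • wI k (t / 2 ^ k) t)
    (k i : ℕ) (hi : 1 ≤ i)
    (u : ℕ → EuclideanSpace ℝ (Fin d))
    (hu : ∀ t, i * 2 ^ k ≤ t → t ≤ (i + 1) * 2 ^ k - 1 → u t ∈ Ω)
    (P : ℝ)
    (hP : P = ∑ t ∈ Finset.Ico (i * 2 ^ k) ((i + 1) * 2 ^ k - 1), ‖u (t + 1) - u t‖) :
    ∑ t ∈ Finset.Icc (i * 2 ^ k) ((i + 1) * 2 ^ k - 1), (f t (w t) - f t (u t))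
      ≤ Real.sqrt (3 * (((i + 1) * 2 ^ k - 1 - i * 2 ^ k + 1 : ℕ) : ℝ) *
            cAOA ((i + 1) * 2 ^ k - 1))
        + 3 * G / 4 * Real.sqrt (2 * (((i + 1) * 2 ^ k - 1 - i * 2 ^ k + 1 : ℕ) : ℝ) *
            (7 * D ^ 2 + 4 * D * P))
        + Real.sqrt (2 * (((i + 1) * 2 ^ k - 1 - i * 2 ^ k + 1 : ℕ) : ℝ)) / 4 *
            (1 + 2 * Real.log (((⌊Real.logb 2 (1 + 4 * P / (7 * D)) / 2⌋₊ + 1 : ℕ) : ℝ) + 1)) := by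
  have hidx : ∀ t k, 2 ^ k ≤ t → 1 ≤ t / 2 ^ k ∧ t / 2 ^ k * 2 ^ k ≤ t ∧
      t < (t / 2 ^ k + 1) * 2 ^ k := fun t k h =>
    ⟨(Nat.one_le_div_iff (Nat.two_pow_pos k)).2 h, Nat.div_mul_le_self _ _,
      Nat.lt_mul_of_div_lt (Nat.lt_succ_self _) (Nat.two_pow_pos k)⟩
  have hlast : ∀ k i, (i + 1) * 2 ^ k - 1 = i * 2 ^ k + (2 ^ k - 1) := fun k i => by
    have := Nat.two_pow_pos k
    rw [add_mul, one_mul]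
    omega
  have hader : ∀ (k i : ℕ) (v : ℕ → EuclideanSpace ℝ (Fin d)),
      (∀ t ≤ 2 ^ k - 1, v t ∈ Ω) → _ := fun k i v hv => by
    have hn : 2 ^ k - 1 + 1 = 2 ^ k := Nat.sub_add_cancel (Nat.two_pow_pos k)
    have h := ader_dynamic_regret hconv hdiam (F := fun t => f (i * 2 ^ k + t))
      (fun t => hfconv _) (fun t => hfdiff _) (fun t => hgrad _) (fun t => hrange _) hproj
      (n := 2 ^ k - 1) (x := fun j t => y k i j (i * 2 ^ k + t))
      (p := fun t j => q k i j (i * 2 ^ k + t)) (hy0 k i)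
      (fun j t ht => by
        rw [hn]
        exact hyup k i j (i * 2 ^ k + t) (Nat.le_add_right _ _) (by rw [hlast]; omega))
      (by rw [hn]; exact hq0 k i)
      (fun t ht j => by
        rw [hn]
        exact hqup k i j (i * 2 ^ k + t) (Nat.le_add_right _ _) (by rw [hlast]; omega))
      hv rfl
    rw [hn] at h
    simp only [← hwI] at h
    exact h
  have hwImem : ∀ k i t, i * 2 ^ k ≤ t → t < (i + 1) * 2 ^ k → wI k i t ∈ Ω := by
    intro k i t h1 h2
    have h := (hader k i (fun _ => y k i 0 (i * 2 ^ k)) fun _ _ => hy0 k i 0).1 (t - i * 2 ^ k)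
      (by have := hlast k i; omega)
    rwa [Nat.add_sub_cancel' h1] at h
  set r : ℕ → ℕ → ℕ → ℝ := fun k i u => f u (w u) - f u (wI k i u) with hr
  have hIcc : ∀ (g : ℕ → ℝ) (a t : ℕ), 1 ≤ t →
      ∑ u ∈ Finset.Icc a (t - 1), g u = ∑ u ∈ Finset.Ico a t, g u := by
    intro g a t ht
    congr 1
    ext u
    simp only [Finset.mem_Icc, Finset.mem_Ico]
    omega
  have hR : ∀ k t, 1 ≤ t → aoaMetaR f w wI k t = intervalSum r k (t / 2 ^ k) t :=
    fun k t ht => hIcc _ _ _ ht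
  have hC : ∀ k t, 1 ≤ t → aoaMetaC f w wI k t =
      intervalSum (fun k i u => |r k i u|) k (t / 2 ^ k) t :=
    fun k t ht => hIcc _ _ _ ht
  have hWnonneg : ∀ k t, 1 ≤ t → 0 ≤ anhW (aoaMetaR f w wI k t) (aoaMetaC f w wI k t) :=
    fun k t ht => anhW_nonneg (by rw [hC k t ht]; exact intervalSum_abs_nonneg _ _ _ _)
  have hWpos : ∀ t, 1 ≤ t →
      0 < ∑ k ∈ gcLevels t, anhW (aoaMetaR f w wI k t) (aoaMetaC f w wI k t) := by
    intro t ht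
    refine Finset.sum_pos' (fun k _ => hWnonneg k t ht) ⟨0, mem_gcLevels.2 (by simpa using ht), ?_⟩
    rw [hR 0 t ht, hC 0 t ht]
    simpa [intervalSum] using anhW_zero_zero_pos
  have hwt_nonneg : ∀ t, 1 ≤ t → ∀ k ∈ gcLevels t, 0 ≤ aoaWeight f w wI k t :=
    fun t ht k _ => div_nonneg (hWnonneg k t ht) (hWpos t ht).le
  have hwt_sum : ∀ t, 1 ≤ t → ∑ k ∈ gcLevels t, aoaWeight f w wI k t = 1 := by
    intro t ht
    unfold aoaWeight
    rw [← Finset.sum_div, div_self (hWpos t ht).ne']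
  have hwImem' : ∀ t, ∀ k ∈ gcLevels t, wI k (t / 2 ^ k) t ∈ Ω := by
    intro t k hk
    obtain ⟨-, h2, h3⟩ := hidx t k (mem_gcLevels.1 hk)
    exact hwImem k _ t h2 h3
  have hwmem : ∀ t, 1 ≤ t → w t ∈ Ω := by
    intro t ht
    rw [hw t ht]
    exact hconv.sum_mem (hwt_nonneg t ht) (hwt_sum t ht) (hwImem' t)
  have hrle : ∀ k i u, 1 ≤ i → i * 2 ^ k ≤ u → u < (i + 1) * 2 ^ k → |r k i u| ≤ 1 := by
    intro k i u hi h1 h2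
    have hu1 : 1 ≤ u := (Nat.mul_pos hi (Nat.two_pow_pos k)).trans_le h1
    obtain ⟨a1, a2⟩ := hrange u _ (hwmem u hu1)
    obtain ⟨b1, b2⟩ := hrange u _ (hwImem k i u h1 h2)
    exact abs_le.2 ⟨by simp only [hr]; linarith, by simp only [hr]; linarith⟩
  have hsum : ∀ t, 1 ≤ t → ∑ k ∈ gcLevels t, anhW (intervalSum r k (t / 2 ^ k) t)
      (intervalSum (fun k i u => |r k i u|) k (t / 2 ^ k) t) * r k (t / 2 ^ k) t ≤ 0 := by
    intro t ht
    have hjensen : f t (w t) ≤ ∑ k ∈ gcLevels t, aoaWeight f w wI k t * f t (wI k (t / 2 ^ k) t) := by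
      nth_rewrite 1 [hw t ht]
      exact (hfconv t).map_sum_le (hwt_nonneg t ht) (hwt_sum t ht) fun _ _ => Set.mem_univ _
    have hle : ∑ k ∈ gcLevels t, aoaWeight f w wI k t * r k (t / 2 ^ k) t ≤ 0 := by
      simp only [hr, mul_sub]
      rw [Finset.sum_sub_distrib, ← Finset.sum_mul, hwt_sum t ht]
      linarith
    have e : ∑ k ∈ gcLevels t, anhW (intervalSum r k (t / 2 ^ k) t)
        (intervalSum (fun k i u => |r k i u|) k (t / 2 ^ k) t) * r k (t / 2 ^ k) t =
        (∑ k ∈ gcLevels t, anhW (aoaMetaR f w wI k t) (aoaMetaC f w wI k t)) *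
          ∑ k ∈ gcLevels t, aoaWeight f w wI k t * r k (t / 2 ^ k) t := by
      rw [Finset.mul_sum]
      refine Finset.sum_congr rfl fun k _ => ?_
      rw [← hR k t ht, ← hC k t ht, aoaWeight, ← mul_assoc, mul_div_cancel₀ _ (hWpos t ht).ne']
    rw [e]
    exact mul_nonpos_of_nonneg_of_nonpos (hWpos t ht).le hle
  have hk0 := Nat.two_pow_pos k
  have hn : 2 ^ k - 1 + 1 = 2 ^ k := Nat.sub_add_cancel hk0
  have hki : 2 ^ k ≤ i * 2 ^ k := Nat.le_mul_of_pos_left _ hi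
  have hlen : (i + 1) * 2 ^ k - 1 - i * 2 ^ k + 1 = 2 ^ k := by
    rw [hlast]
    omega
  have hdiv : ((i + 1) * 2 ^ k - 1) / 2 ^ k = i := by
    rw [hlast, add_comm, Nat.add_mul_div_right _ _ hk0, Nat.div_eq_of_lt (by omega), zero_add]
  have hmeta := intervalSum_le_sqrt hrle hsum (k := k) (t := (i + 1) * 2 ^ k - 1)
    (by rw [hlast]; omega)
  have hreg := (hader k i (fun t => u (i * 2 ^ k + t)) fun t ht =>
    hu _ (Nat.le_add_right _ _) (by rw [hlast]; omega)).2
  have hrange_sum : ∀ g : ℕ → ℝ, ∑ t ∈ Finset.Ico (i * 2 ^ k) (i * 2 ^ k + (2 ^ k - 1) + 1), g t =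
      ∑ t ∈ Finset.range (2 ^ k), g (i * 2 ^ k + t) := by
    intro g
    rw [Finset.sum_Ico_eq_sum_range, add_assoc, hn, Nat.add_sub_cancel_left]
  have hPath : ∑ t ∈ Finset.range (2 ^ k - 1), ‖u (i * 2 ^ k + (t + 1)) - u (i * 2 ^ k + t)‖ = P := by
    rw [hP, hlast, Finset.sum_Ico_eq_sum_range, Nat.add_sub_cancel_left]
    rfl
  rw [hPath] at hreg
  rw [hdiv, hlast, intervalSum, hrange_sum] at hmeta
  have hIcc' : Finset.Icc (i * 2 ^ k) ((i + 1) * 2 ^ k - 1) =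
      Finset.Ico (i * 2 ^ k) (i * 2 ^ k + (2 ^ k - 1) + 1) := by
    ext t
    rw [hlast]
    simp only [Finset.mem_Icc, Finset.mem_Ico]
    omega
  rw [hlen, hIcc', hlast, hrange_sum]
  have hsplit : ∑ t ∈ Finset.range (2 ^ k),
      (f (i * 2 ^ k + t) (w (i * 2 ^ k + t)) - f (i * 2 ^ k + t) (u (i * 2 ^ k + t))) =
      ∑ t ∈ Finset.range (2 ^ k), r k i (i * 2 ^ k + t) +
      ∑ t ∈ Finset.range (2 ^ k),
        (f (i * 2 ^ k + t) (wI k i (i * 2 ^ k + t)) - f (i * 2 ^ k + t) (u (i * 2 ^ k + t))) := by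
    rw [← Finset.sum_add_distrib]
    exact Finset.sum_congr rfl fun t _ => by simp only [hr]; ring
  rw [hsplit]
  beta_reduce at hreg
  push_cast at hmeta hreg ⊢
  linarith
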